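/- arXiv:0905.3107 — 2 statements merged into one kernel-verified Lean document; each statement's English description precedes it below -/
import Mathlib

section
/- Let φ = (1+√5)/2 denote the golden ratio. For every finite alphabet A of size n ≥ 2, every probability distribution p on A, and every real ε with 0 < ε < 1, setting L = ⌈log₂ n⌉ + ⌈log₂(2/ε)⌉, there exists a binary prefix code C on A whose maximum codeword length is at most L and such that for every binary prefix code ψ on A, the expected codeword length of C under p is at most the expected codeword length of ψ under p plus ε^{log₂ φ}. -/
/-- A binary prefix code on an alphabet `A`: an injective assignment of binary
strings such that no codeword is a prefix of another character's codeword. -/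
def IsPrefixCode {A : Type*} (C : A → List Bool) : Prop :=
  Function.Injective C ∧ ∀ a b : A, a ≠ b → ¬ (C a <+: C b)

/-- Expected codeword length of the code `C` under the distribution `p`. -/
noncomputable def expLen {A : Type*} [Fintype A] (p : A → ℝ) (C : A → List Bool) : ℝ :=
  ∑ a, p a * (C a).length

/-- The total weight of the characters whose codeword extends the string `s`. -/
noncomputable def subtreeWeight {A : Type*} [Fintype A] (p : A → ℝ) (C : A → List Bool)
    (s : List Bool) : ℝ :=
  ∑ a, if s <+: C a then p a else 0

/-- Exchange the subtrees of the code tree hanging at `s` and `t`. -/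
def swapSubtrees {A : Type*} (C : A → List Bool) (s t : List Bool) (a : A) : List Bool :=
  if s <+: C a then t ++ (C a).drop s.length
  else if t <+: C a then s ++ (C a).drop t.length
  else C a

/-- Hang the codewords of length at least `L`, re-encoded by `E`, next to the subtree at `u`,
which moves one level down. -/
def rehang {A : Type*} (C E : A → List Bool) (L : ℕ) (u : List Bool) (a : A) : List Bool :=
  if L ≤ (C a).length then u ++ true :: E a
  else if u <+: C a then u ++ false :: (C a).drop u.length
  else C a

theorem isPrefixCode_of_not_prefix {A : Type*} {C : A → List Bool}
    (h : ∀ a b : A, a ≠ b → ¬ (C a <+: C b)) : IsPrefixCode C := by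
  refine ⟨fun a b hab => ?_, h⟩
  by_contra hne
  exact h a b hne (hab ▸ List.prefix_rfl)

theorem prefix_or_prefix_of_prefix_append {x s y : List Bool} (h : x <+: s ++ y) :
    x <+: s ∨ s <+: x :=
  List.prefix_or_prefix_of_prefix h (List.prefix_append s y)

theorem isPrefixCode_swapSubtrees {A : Type*} {C : A → List Bool} (hC : IsPrefixCode C)
    {s t : List Bool} (hst : ¬ s <+: t) (hts : ¬ t <+: s)
    (hs : ∀ a, C a <+: s → s <+: C a) (ht : ∀ a, C a <+: t → t <+: C a) :
    IsPrefixCode (swapSubtrees C s t) := by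
  refine isPrefixCode_of_not_prefix fun a b hab h => ?_
  have hC' := hC.2 a b hab
  have drop_eq : ∀ (r : List Bool) (c : A), r <+: C c → r ++ (C c).drop r.length = C c :=
    fun r c hr => List.prefix_append_drop hr |>.symm
  unfold swapSubtrees at h
  split_ifs at h with h1 h2 h3 h4 h5 h6 h7 h8
  · rw [List.prefix_append_right_inj] at h
    apply hC'
    rw [← drop_eq s a h1, ← drop_eq s b h2]
    simpa using h
  · rcases prefix_or_prefix_of_prefix_append ((List.prefix_append _ _).trans h) with h | h
    exacts [hts h, hst h]
  · exact h3 ((List.prefix_append _ _).trans h)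
  · rcases prefix_or_prefix_of_prefix_append ((List.prefix_append _ _).trans h) with h | h
    exacts [hst h, hts h]
  · rw [List.prefix_append_right_inj] at h
    apply hC'
    rw [← drop_eq t a h4, ← drop_eq t b h6]
    simpa using h
  · exact h5 ((List.prefix_append _ _).trans h)
  · rcases prefix_or_prefix_of_prefix_append h with h | h
    exacts [h4 (ht a h), h4 h]
  · rcases prefix_or_prefix_of_prefix_append h with h | h
    exacts [h1 (hs a h), h1 h]
  · exact hC' h

theorem expLen_swapSubtrees {A : Type*} [Fintype A] (p : A → ℝ) (C : A → List Bool)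
    {s t : List Bool} (hst : ¬ s <+: t) (hts : ¬ t <+: s) :
    expLen p (swapSubtrees C s t) = expLen p C +
      ((t.length : ℝ) - s.length) * (subtreeWeight p C s - subtreeWeight p C t) := by
  unfold expLen subtreeWeight
  rw [← Finset.sum_sub_distrib, Finset.mul_sum, ← Finset.sum_add_distrib]
  refine Finset.sum_congr rfl fun a _ => ?_
  unfold swapSubtrees
  by_cases h1 : s <+: C a
  · have h2 : ¬ t <+: C a := fun h2 =>
      (List.prefix_or_prefix_of_prefix h1 h2).elim hst hts
    have := h1.length_le
    simp only [h1, h2, if_true, if_false, List.length_append, List.length_drop]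
    push_cast [this]
    ring
  · by_cases h2 : t <+: C a
    · have := h2.length_le
      simp only [h1, h2, if_true, if_false, List.length_append, List.length_drop]
      push_cast [this]
      ring
    · simp [h1, h2]

theorem subtreeWeight_nonneg {A : Type*} [Fintype A] {p : A → ℝ} (hp : ∀ a, 0 ≤ p a)
    (C : A → List Bool) (s : List Bool) : 0 ≤ subtreeWeight p C s :=
  Finset.sum_nonneg fun a _ => by split_ifs <;> simp [hp a]

theorem subtreeWeight_nil {A : Type*} [Fintype A] (p : A → ℝ) (C : A → List Bool) :
    subtreeWeight p C [] = ∑ a, p a := by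
  simp [subtreeWeight]

theorem not_append_singleton_prefix {q r : List Bool} {b c : Bool} (hbc : b ≠ c) :
    ¬ q ++ [b] <+: q ++ c :: r := by
  rw [List.prefix_append_right_inj]
  simp [hbc]

theorem subtreeWeight_children_le {A : Type*} [Fintype A] {p : A → ℝ} (hp : ∀ a, 0 ≤ p a)
    (C : A → List Bool) (q : List Bool) (b : Bool) :
    subtreeWeight p C (q ++ [b]) + subtreeWeight p C (q ++ [!b]) ≤ subtreeWeight p C q := by
  unfold subtreeWeight
  rw [← Finset.sum_add_distrib]
  refine Finset.sum_le_sum fun a _ => ?_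
  by_cases h1 : q ++ [b] <+: C a
  · have h2 : ¬ q ++ [!b] <+: C a := fun h2 =>
      (List.prefix_or_prefix_of_prefix h1 h2).elim
        (not_append_singleton_prefix (by simp)) (not_append_singleton_prefix (by simp))
    simp [h1, h2, (List.prefix_append q [b]).trans h1]
  · by_cases h2 : q ++ [!b] <+: C a
    · simp [h1, h2, (List.prefix_append q [!b]).trans h2]
    · simp only [h1, h2, if_false]
      split_ifs <;> simp [hp a]

theorem prefix_of_prefix_append_singleton {x q : List Bool} {b : Bool}
    (hx : ¬ x <+: q) (h : x <+: q ++ [b]) : q ++ [b] <+: x := by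
  rcases List.prefix_concat_iff.1 h with h | h
  · rw [h]
  · exact absurd h hx

/-- In an optimal code, a node weighs at least as much as a child and a grandchild through it. -/
theorem subtreeWeight_child_add_grandchild_le {A : Type*} [Fintype A] {p : A → ℝ}
    (hp : ∀ a, 0 ≤ p a) {C : A → List Bool} (hC : IsPrefixCode C)
    (hopt : ∀ ψ : A → List Bool, IsPrefixCode ψ → expLen p C ≤ expLen p ψ)
    {q : List Bool} {b : Bool} (hq : ∀ a, ¬ C a <+: q ++ [b]) (c : Bool) :
    subtreeWeight p C (q ++ [b]) + subtreeWeight p C (q ++ [b] ++ [c]) ≤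
      subtreeWeight p C q := by
  have hst : ¬ q ++ [!b] <+: q ++ [b] ++ [c] := by
    simp
  have hts : ¬ q ++ [b] ++ [c] <+: q ++ [!b] := fun h => by
    have := h.length_le
    simp at this
  have hle := hopt _ (isPrefixCode_swapSubtrees hC hst hts
    (fun a h => prefix_of_prefix_append_singleton
      (fun h' => hq a (h'.trans (List.prefix_append _ _))) h)
    (fun a h => prefix_of_prefix_append_singleton (hq a) h))
  rw [expLen_swapSubtrees p C hst hts] at hle
  have := subtreeWeight_children_le hp C q b
  simp only [List.length_append, List.length_singleton] at hle
  push_cast at hle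
  linarith

/-- Fibonacci growth of the weights along a path in an optimal code. -/
theorem fib_mul_subtreeWeight_le {A : Type*} [Fintype A] {p : A → ℝ}
    (hp : ∀ a, 0 ≤ p a) {C : A → List Bool} (hC : IsPrefixCode C)
    (hopt : ∀ ψ : A → List Bool, IsPrefixCode ψ → expLen p C ≤ expLen p ψ)
    (x : List Bool) (hx : ∀ a, ¬ C a <+: x) (b : Bool) :
    (Nat.fib (x.length + 1) : ℝ) * subtreeWeight p C x +
      Nat.fib x.length * subtreeWeight p C (x ++ [b]) ≤ ∑ a, p a := by
  induction x using List.reverseRecOn generalizing b with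
  | nil => simp [subtreeWeight_nil]
  | append_singleton x c ih =>
    have h1 := ih (fun a h => hx a (h.trans (List.prefix_append _ _))) c
    have h2 := mul_le_mul_of_nonneg_left
      (subtreeWeight_child_add_grandchild_le hp hC hopt hx b)
      (Nat.cast_nonneg (α := ℝ) (Nat.fib (x.length + 1)))
    simp only [List.length_append, List.length_singleton]
    rw [Nat.fib_add_two (n := x.length)]
    push_cast
    linarith

theorem goldenRatio_pow_le_fib (k : ℕ) : Real.goldenRatio ^ k ≤ Nat.fib (k + 2) := by
  induction k using Nat.twoStepInduction with
  | zero => simp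
  | one =>
    have := Real.goldenRatio_lt_two
    simpa [Nat.fib_add_two] using this.le
  | more k ih1 ih2 =>
    rw [Nat.fib_add_two, pow_add, Real.goldenRatio_sq]
    push_cast
    rw [pow_succ] at ih2
    linarith

/-- A small node on level `k + 1` of an optimal code, below a given non-codeword of length `k`. -/
theorem exists_goldenRatio_pow_mul_subtreeWeight_le {A : Type*} [Fintype A] {p : A → ℝ}
    (hp : ∀ a, 0 ≤ p a) {C : A → List Bool} (hC : IsPrefixCode C)
    (hopt : ∀ ψ : A → List Bool, IsPrefixCode ψ → expLen p C ≤ expLen p ψ)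
    (x : List Bool) (hx : ∀ a, ¬ C a <+: x) :
    ∃ b : Bool, Real.goldenRatio ^ (x.length + 1) * subtreeWeight p C (x ++ [b]) ≤
      ∑ a, p a := by
  obtain ⟨b, hb⟩ : ∃ b : Bool,
      subtreeWeight p C (x ++ [b]) ≤ subtreeWeight p C (x ++ [!b]) := by
    rcases le_total (subtreeWeight p C (x ++ [true])) (subtreeWeight p C (x ++ [false]))
      with h | h
    exacts [⟨true, h⟩, ⟨false, h⟩]
  refine ⟨b, ?_⟩
  have h1 := fib_mul_subtreeWeight_le hp hC hopt x hx b
  have h2 := subtreeWeight_children_le hp C x b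
  have h3 := mul_le_mul_of_nonneg_right (goldenRatio_pow_le_fib (x.length + 1))
    (subtreeWeight_nonneg hp C (x ++ [b]))
  have h4 : 2 * subtreeWeight p C (x ++ [b]) ≤ subtreeWeight p C x := by linarith
  have h5 := mul_le_mul_of_nonneg_left h4
    (Nat.cast_nonneg (α := ℝ) (Nat.fib (x.length + 1)))
  have h6 : (Nat.fib (x.length + 1 + 2) : ℝ) =
      2 * Nat.fib (x.length + 1) + Nat.fib x.length := by
    rw [Nat.fib_add_two, Nat.fib_add_two (n := x.length)]
    push_cast
    ring
  rw [h6] at h3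
  linarith

theorem exists_optimal_prefixCode {A : Type*} [Fintype A] {p : A → ℝ} (hp : ∀ a, 0 ≤ p a)
    {E : A → List Bool} (hE : IsPrefixCode E) :
    ∃ C : A → List Bool, IsPrefixCode C ∧
      ∀ ψ : A → List Bool, IsPrefixCode ψ → expLen p C ≤ expLen p ψ := by
  let S : Set (A → ℕ) := (fun C a => (C a).length) '' {C : A → List Bool | IsPrefixCode C}
  let f : (A → ℕ) → ℝ := fun l => ∑ a, p a * l a
  have hf : Monotone f := fun l l' h => Finset.sum_le_sum fun a _ =>
    mul_le_mul_of_nonneg_left (Nat.cast_le.2 (h a)) (hp a)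
  have hwf : (f '' S).IsWF := ((Set.isPWO_of_wellQuasiOrderedLE S).image_of_monotone hf).isWF
  have hne : (f '' S).Nonempty := ⟨_, _, ⟨E, hE, rfl⟩, rfl⟩
  obtain ⟨_, ⟨C, hC, rfl⟩, hmin⟩ := hwf.min_mem hne
  refine ⟨C, hC, fun ψ hψ => ?_⟩
  have := hwf.min_le hne ⟨_, ⟨ψ, hψ, rfl⟩, rfl⟩
  rw [← hmin] at this
  exact this

theorem exists_fixed_length_code {A : Type*} [Fintype A] {m : ℕ}
    (h : Fintype.card A ≤ 2 ^ m) :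
    ∃ E : A → List Bool, IsPrefixCode E ∧ ∀ a, (E a).length = m := by
  have hc : Fintype.card A ≤ Fintype.card (List.Vector Bool m) := by simpa using h
  obtain ⟨e⟩ := Function.Embedding.nonempty_of_card_le hc
  refine ⟨fun a => (e a).1, isPrefixCode_of_not_prefix fun a b hab hpre => ?_, fun a => (e a).2⟩
  exact hab (e.injective (Subtype.ext (hpre.eq_of_length ((e a).2.trans (e b).2.symm))))

theorem isPrefixCode_rehang {A : Type*} {C E : A → List Bool} (hC : IsPrefixCode C)
    (hE : IsPrefixCode E) (L : ℕ) {u : List Bool} (hu : ∀ a, C a <+: u → u <+: C a) :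
    IsPrefixCode (rehang C E L u) := by
  refine isPrefixCode_of_not_prefix fun a b hab h => ?_
  have hC' := hC.2 a b hab
  unfold rehang at h
  split_ifs at h with h1 h2 h3 h4 h5 h6 h7 h8
  · simp only [List.prefix_append_right_inj, List.cons_prefix_cons, true_and] at h
    exact hE.2 a b hab h
  · simp [List.prefix_append_right_inj] at h
  · exact h3 ((List.prefix_append _ _).trans h)
  · simp [List.prefix_append_right_inj] at h
  · simp only [List.prefix_append_right_inj, List.cons_prefix_cons, true_and] at h
    apply hC'
    rw [List.prefix_append_drop h4, List.prefix_append_drop h6]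
    simpa [List.prefix_append_right_inj] using h
  · exact h6 ((List.prefix_append _ _).trans h)
  · rcases prefix_or_prefix_of_prefix_append h with h | h
    exacts [h4 (hu a h), h4 h]
  · rcases prefix_or_prefix_of_prefix_append h with h | h
    exacts [h4 (hu a h), h4 h]
  · exact hC' h

theorem length_rehang_le {A : Type*} {C E : A → List Bool} {L m : ℕ} {u : List Bool}
    (hE : ∀ a, (E a).length = m) (hL : L = u.length + 1 + m) (a : A) :
    (rehang C E L u a).length ≤ L := by
  unfold rehang
  split_ifs with h1 h2
  · simp [hE]; omega
  · have := h2.length_le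
    simp; omega
  · omega

theorem expLen_rehang_le {A : Type*} [Fintype A] {p : A → ℝ} (hp : ∀ a, 0 ≤ p a)
    {C E : A → List Bool} {L m : ℕ} {u : List Bool}
    (hE : ∀ a, (E a).length = m) (hL : L = u.length + 1 + m) :
    expLen p (rehang C E L u) ≤ expLen p C + subtreeWeight p C u := by
  unfold expLen subtreeWeight
  rw [← Finset.sum_add_distrib]
  refine Finset.sum_le_sum fun a _ => ?_
  have key : (rehang C E L u a).length ≤ (C a).length + if u <+: C a then 1 else 0 := by
    by_cases h1 : L ≤ (C a).length
    · exact (length_rehang_le hE hL a).trans (h1.trans (Nat.le_add_right _ _))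
    · unfold rehang
      rw [if_neg h1]
      split_ifs with h2
      · have := h2.length_le
        simp; omega
      · simp
  have key' := mul_le_mul_of_nonneg_left (Nat.cast_le (α := ℝ).2 key) (hp a)
  refine key'.trans (le_of_eq ?_)
  split_ifs <;> push_cast <;> ring

/-- Limiting the codeword length to `m + k + 2` costs at most `φ⁻¹ ^ (k + 1)`. -/
theorem exists_length_limited_code {A : Type*} [Fintype A] {p : A → ℝ} (hp : ∀ a, 0 ≤ p a)
    (hp1 : ∑ a, p a = 1) {m : ℕ} (hm : Fintype.card A ≤ 2 ^ m) (k : ℕ) :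
    ∃ C : A → List Bool, IsPrefixCode C ∧ (∀ a, (C a).length ≤ m + k + 2) ∧
      ∀ ψ : A → List Bool, IsPrefixCode ψ →
        expLen p C ≤ expLen p ψ + (Real.goldenRatio ^ (k + 1))⁻¹ := by
  obtain ⟨E, hE, hEm⟩ := exists_fixed_length_code hm
  obtain ⟨C, hC, hopt⟩ := exists_optimal_prefixCode hp hE
  have hpos : 0 < Real.goldenRatio ^ (k + 1) := pow_pos Real.goldenRatio_pos _
  by_cases hshort : ∀ a, (C a).length ≤ m + k + 2
  · exact ⟨C, hC, hshort, fun ψ hψ =>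
      (hopt ψ hψ).trans (le_add_of_nonneg_right (inv_nonneg.2 hpos.le))⟩
  push Not at hshort
  obtain ⟨a₀, ha₀⟩ := hshort
  have hxlen : ((C a₀).take k).length = k := by
    rw [List.length_take]; omega
  have hx : ∀ a, ¬ C a <+: (C a₀).take k := fun a h => by
    have hlen := h.length_le
    by_cases haa : a = a₀
    · subst haa; omega
    · exact hC.2 a a₀ haa (h.trans (List.take_prefix _ _))
  obtain ⟨b, hb⟩ := exists_goldenRatio_pow_mul_subtreeWeight_le hp hC hopt _ hx
  rw [hxlen, hp1] at hb
  have hulen : m + k + 2 = ((C a₀).take k ++ [b]).length + 1 + m := by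
    rw [List.length_append, hxlen, List.length_singleton]; omega
  refine ⟨rehang C E (m + k + 2) ((C a₀).take k ++ [b]),
    isPrefixCode_rehang hC hE _ fun a h => prefix_of_prefix_append_singleton (hx a) h,
    length_rehang_le hEm hulen, fun ψ hψ => ?_⟩
  have h1 := expLen_rehang_le hp (C := C) hEm hulen
  have h2 : subtreeWeight p C ((C a₀).take k ++ [b]) ≤ (Real.goldenRatio ^ (k + 1))⁻¹ := by
    rw [← one_div, le_div_iff₀' hpos]
    exact hb
  linarith [hopt ψ hψ]

theorem inv_goldenRatio_pow_le_rpow {ε : ℝ} (hε : 0 < ε) {d : ℕ}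
    (hd : -Real.logb 2 ε ≤ d) :
    (Real.goldenRatio ^ d)⁻¹ ≤ ε ^ Real.logb 2 Real.goldenRatio := by
  have h : ε ^ Real.logb 2 Real.goldenRatio = Real.goldenRatio ^ Real.logb 2 ε := by
    rw [Real.rpow_def_of_pos hε, Real.rpow_def_of_pos Real.goldenRatio_pos, Real.logb,
      Real.logb]
    ring_nf
  rw [h, ← Real.rpow_natCast, ← Real.rpow_neg Real.goldenRatio_pos.le]
  exact Real.rpow_le_rpow_of_exponent_le Real.one_lt_goldenRatio.le (by linarith)

theorem stmt1 {A : Type*} [Fintype A] (n : ℕ) (hn : 2 ≤ n) (hcard : Fintype.card A = n)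
    (p : A → ℝ) (hp0 : ∀ a, 0 ≤ p a) (hp1 : ∑ a, p a = 1)
    (ε : ℝ) (hε0 : 0 < ε) (hε1 : ε < 1)
    (L : ℤ) (hL : L = ⌈Real.logb 2 n⌉ + ⌈Real.logb 2 (2 / ε)⌉) :
    ∃ C : A → List Bool, IsPrefixCode C ∧
      (∀ a, ((C a).length : ℤ) ≤ L) ∧
      (∀ ψ : A → List Bool, IsPrefixCode ψ →
        expLen p C ≤ expLen p ψ + ε ^ Real.logb 2 ((1 + Real.sqrt 5) / 2)) := by
  have hn0 : (0 : ℝ) < n := by exact_mod_cast (by omega : 0 < n)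
  have hm0 : 0 ≤ ⌈Real.logb 2 n⌉ := Int.ceil_nonneg
    (Real.logb_nonneg one_lt_two (by exact_mod_cast (by omega : 1 ≤ n)))
  obtain ⟨m, hm⟩ := Int.eq_ofNat_of_zero_le hm0
  have hcard' : Fintype.card A ≤ 2 ^ m := by
    have h := Int.le_ceil (Real.logb 2 n)
    rw [hm, Real.logb_le_iff_le_rpow one_lt_two hn0] at h
    simp only [Int.cast_natCast, Real.rpow_natCast] at h
    rw [hcard]
    exact_mod_cast h
  have hlog : Real.logb 2 (2 / ε) = -Real.logb 2 ε + 1 := by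
    rw [Real.logb_div two_ne_zero hε0.ne', Real.logb_self_eq_one one_lt_two]
    ring
  have hd0 : 0 < ⌈-Real.logb 2 ε⌉ := Int.ceil_pos.2
    (neg_pos.2 (Real.logb_neg one_lt_two hε0 hε1))
  obtain ⟨k, hk⟩ := Int.eq_ofNat_of_zero_le (Int.le_sub_one_of_lt hd0)
  have hk' : ⌈-Real.logb 2 ε⌉ = ((k + 1 : ℕ) : ℤ) := by push_cast; omega
  obtain ⟨C, hC, hlen, hcost⟩ := exists_length_limited_code hp0 hp1 hcard' k
  refine ⟨C, hC, fun a => ?_, fun ψ hψ => (hcost ψ hψ).trans ?_⟩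
  · rw [hL, hlog, Int.ceil_add_one, hm, hk']
    have := hlen a
    push_cast
    omega
  · have h := Int.le_ceil (-Real.logb 2 ε)
    rw [hk', Int.cast_natCast] at h
    have := inv_goldenRatio_pow_le_rpow hε0 h
    rw [Real.goldenRatio] at this ⊢
    linarith
end

section
/- Let A be a finite alphabet of size n ≥ 2 and let ℓ : A → ℕ satisfy ∑_{a∈A} 2^{−ℓ(a)} = 1. Define the (dyadic) probability distribution p on A by p(a) = 2^{−ℓ(a)}. If C is a binary prefix code on A whose expected codeword length under p is less than or equal to that of every binary prefix code on A, then |C a| = ℓ(a) for every a ∈ A. -/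
/-- The finite set of binary words of length `N`. -/
def binaryWords (N : ℕ) : Finset (List Bool) :=
  (Finset.univ : Finset (List.Vector Bool N)).map ⟨List.Vector.toList, List.Vector.toList_injective⟩

lemma mem_binaryWords {N : ℕ} {w : List Bool} : w ∈ binaryWords N ↔ w.length = N := by
  refine Finset.mem_map.trans ⟨fun ⟨v, _, hv⟩ => hv ▸ v.2, fun h => ?_⟩
  exact ⟨⟨w, h⟩, Finset.mem_univ _, rfl⟩

lemma card_binaryWords (N : ℕ) : (binaryWords N).card = 2 ^ N :=
  (Finset.card_map _).trans (card_vector N)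

/-- If the Kraft sum of finitely many words of length at most `N` is less than `1`, some word of
length `N` extends none of them. -/
lemma exists_length_eq_not_extending {A : Type*} (s : Finset A) (C : A → List Bool) (N : ℕ)
    (hN : ∀ b ∈ s, (C b).length ≤ N) (hs : ∑ b ∈ s, (2 : ℝ)⁻¹ ^ (C b).length < 1) :
    ∃ w : List Bool, w.length = N ∧ ∀ b ∈ s, ¬ C b <+: w := by
  classical
  let T := s.biUnion fun b => (binaryWords (N - (C b).length)).image (C b ++ ·)
  have hT : T.card < (binaryWords N).card := by
    have hle : T.card ≤ ∑ b ∈ s, 2 ^ (N - (C b).length) :=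
      Finset.card_biUnion_le.trans <| Finset.sum_le_sum fun b _ =>
        Finset.card_image_le.trans (card_binaryWords _).le
    have hlt : ((∑ b ∈ s, 2 ^ (N - (C b).length) : ℕ) : ℝ) < 2 ^ N := by
      have heq : ((∑ b ∈ s, 2 ^ (N - (C b).length) : ℕ) : ℝ)
          = 2 ^ N * ∑ b ∈ s, (2 : ℝ)⁻¹ ^ (C b).length := by
        push_cast
        rw [Finset.mul_sum]
        refine Finset.sum_congr rfl fun b hb => ?_
        rw [pow_sub₀ _ two_ne_zero (hN b hb), inv_pow]
      rw [heq]
      exact mul_lt_of_lt_one_right (by positivity) hs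
    rw [card_binaryWords]
    exact hle.trans_lt (by exact_mod_cast hlt)
  obtain ⟨w, hw, hwT⟩ := Finset.exists_mem_notMem_of_card_lt_card hT
  rw [mem_binaryWords] at hw
  refine ⟨w, hw, fun b hb ⟨t, ht⟩ => hwT ?_⟩
  refine Finset.mem_biUnion.2 ⟨b, hb, Finset.mem_image.2 ⟨t, mem_binaryWords.2 ?_, ht⟩⟩
  rw [← hw, ← ht, List.length_append]
  omega

/-- Converse of Kraft's inequality, on a finite subset of the alphabet. -/
lemma exists_prefixFree_on {A : Type*} (ℓ : A → ℕ) (s : Finset A)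
    (hs : ∑ a ∈ s, (2 : ℝ)⁻¹ ^ ℓ a ≤ 1) :
    ∃ C : A → List Bool, (∀ a ∈ s, (C a).length = ℓ a) ∧
      ∀ a ∈ s, ∀ b ∈ s, a ≠ b → ¬ C a <+: C b := by
  classical
  induction s using Finset.induction_on_max_value ℓ with
  | empty => exact ⟨fun _ => [], by simp, by simp⟩
  | insert a s ha hmax ih =>
    rw [Finset.sum_insert ha] at hs
    have hpos : (0 : ℝ) < 2⁻¹ ^ ℓ a := by positivity
    obtain ⟨C, hlen, hpre⟩ := ih (by linarith)
    have hsum : ∑ b ∈ s, (2 : ℝ)⁻¹ ^ (C b).length = ∑ b ∈ s, (2 : ℝ)⁻¹ ^ ℓ b :=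
      Finset.sum_congr rfl fun b hb => by rw [hlen b hb]
    obtain ⟨w, hw, hwC⟩ := exists_length_eq_not_extending s C (ℓ a)
      (fun b hb => (hlen b hb).trans_le (hmax b hb)) (by linarith)
    have hne : ∀ b ∈ s, b ≠ a := fun b hb h => ha (h ▸ hb)
    refine ⟨Function.update C a w, fun b hb => ?_, fun b hb c hc hbc => ?_⟩
    · rcases Finset.mem_insert.1 hb with rfl | hb
      · simpa using hw
      · simpa [hne b hb] using hlen b hb
    · rcases Finset.mem_insert.1 hb with rfl | hbs <;>
        rcases Finset.mem_insert.1 hc with rfl | hcs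
      · exact absurd rfl hbc
      · rw [Function.update_self, Function.update_of_ne (hne c hcs)]
        intro h
        have hle : (C c).length ≤ w.length := by rw [hw, hlen c hcs]; exact hmax c hcs
        exact hwC c hcs (h.eq_of_length_le hle ▸ List.prefix_rfl)
      · rw [Function.update_self, Function.update_of_ne (hne b hbs)]
        exact hwC b hbs
      · rw [Function.update_of_ne (hne b hbs), Function.update_of_ne (hne c hcs)]
        exact hpre b hbs c hcs hbc

/-- Converse of Kraft's inequality. -/
lemma exists_isPrefixCode_length_eq {A : Type*} [Fintype A] (ℓ : A → ℕ)
    (hℓ : ∑ a, (2 : ℝ)⁻¹ ^ ℓ a ≤ 1) :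
    ∃ C : A → List Bool, IsPrefixCode C ∧ ∀ a, (C a).length = ℓ a := by
  obtain ⟨C, hlen, hpre⟩ := exists_prefixFree_on ℓ Finset.univ hℓ
  have hpre' : ∀ a b : A, a ≠ b → ¬ C a <+: C b := fun a b =>
    hpre a (Finset.mem_univ a) b (Finset.mem_univ b)
  refine ⟨C, ⟨fun a b hab => ?_, hpre'⟩, fun a => hlen a (Finset.mem_univ a)⟩
  by_contra hne
  exact hpre' a b hne (hab ▸ List.prefix_rfl)

lemma IsPrefixCode.ne_nil {A : Type*} [Nontrivial A] {C : A → List Bool} (hC : IsPrefixCode C)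
    (a : A) : C a ≠ [] := by
  obtain ⟨b, hb⟩ := exists_ne a
  exact fun h => hC.2 a b hb.symm (by simp [h])

lemma IsPrefixCode.uniquelyDecodable {A : Type*} [Nontrivial A] {C : A → List Bool}
    (hC : IsPrefixCode C) : InformationTheory.UniquelyDecodable (Set.range C) := by
  intro L₁
  induction L₁ with
  | nil =>
    rintro (_ | ⟨w, L₂⟩) - h₂ h
    · rfl
    · obtain ⟨a, rfl⟩ := h₂ w (by simp)
      simp [hC.ne_nil a] at h
  | cons v L₁ ih =>
    rintro (_ | ⟨w, L₂⟩) h₁ h₂ h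
    · obtain ⟨a, rfl⟩ := h₁ v (by simp)
      simp [hC.ne_nil a] at h
    · obtain ⟨a, rfl⟩ := h₁ v (by simp)
      obtain ⟨b, rfl⟩ := h₂ w (by simp)
      rw [List.flatten_cons, List.flatten_cons] at h
      have hab : a = b := by
        by_contra hne
        have ha : C a <+: C a ++ L₁.flatten := List.prefix_append _ _
        have hb : C b <+: C a ++ L₁.flatten := h ▸ List.prefix_append _ _
        rcases le_total (C a).length (C b).length with hle | hle
        · exact hC.2 a b hne (List.prefix_of_prefix_length_le ha hb hle)
        · exact hC.2 b a (Ne.symm hne) (List.prefix_of_prefix_length_le hb ha hle)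
      subst hab
      rw [ih L₂ (fun x hx => h₁ x (List.mem_cons_of_mem _ hx))
        (fun x hx => h₂ x (List.mem_cons_of_mem _ hx)) (List.append_cancel_left h)]

/-- Kraft's inequality for prefix codes. -/
lemma IsPrefixCode.kraft {A : Type*} [Fintype A] [Nontrivial A] {C : A → List Bool}
    (hC : IsPrefixCode C) : ∑ a, (2 : ℝ)⁻¹ ^ (C a).length ≤ 1 := by
  have h := InformationTheory.kraft_mcmillan_inequality
    (S := Finset.univ.map ⟨C, hC.1⟩) (by simpa using hC.uniquelyDecodable)
  simpa using h

/-- The tangent line inequality for `2⁻¹ ^ ·`, strict away from the point of tangency. -/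
lemma inv_two_pow_tangent_lt {k m : ℕ} (h : m ≠ k) :
    (2 : ℝ)⁻¹ ^ k * (1 - Real.log 2 * (m - k)) < 2⁻¹ ^ m := by
  have hexp : ∀ j : ℕ, (2 : ℝ)⁻¹ ^ j = Real.exp (-(Real.log 2 * j)) := fun j => by
    rw [Real.exp_neg, mul_comm, Real.exp_nat_mul, Real.exp_log two_pos, inv_pow]
  have hne : -(Real.log 2 * ((m : ℝ) - k)) ≠ 0 :=
    neg_ne_zero.2 <| mul_ne_zero (Real.log_pos one_lt_two).ne' <|
      sub_ne_zero.2 <| Nat.cast_injective.ne h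
  have hlt := Real.add_one_lt_exp hne
  calc (2 : ℝ)⁻¹ ^ k * (1 - Real.log 2 * (m - k))
      < 2⁻¹ ^ k * Real.exp (-(Real.log 2 * ((m : ℝ) - k))) := by
        gcongr
        linarith
    _ = 2⁻¹ ^ m := by
        rw [hexp, hexp, ← Real.exp_add]
        ring_nf

/-- Gibbs' inequality for dyadic distributions, with its equality case: a Kraft-admissible length
function that is at most as long on average as `ℓ` is `ℓ` itself. -/
lemma length_eq_of_sum_mul_le {A : Type*} [Fintype A] {ℓ m : A → ℕ}
    (hℓ : ∑ a, (2 : ℝ)⁻¹ ^ ℓ a = 1) (hm : ∑ a, (2 : ℝ)⁻¹ ^ m a ≤ 1)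
    (h : ∑ a, (2 : ℝ)⁻¹ ^ ℓ a * m a ≤ ∑ a, (2 : ℝ)⁻¹ ^ ℓ a * ℓ a) : m = ℓ := by
  by_contra hne
  obtain ⟨a, ha⟩ := Function.ne_iff.1 hne
  have hlt : ∑ a, (2 : ℝ)⁻¹ ^ ℓ a * (1 - Real.log 2 * (m a - ℓ a)) < ∑ a, (2 : ℝ)⁻¹ ^ m a := by
    refine Finset.sum_lt_sum (fun b _ => ?_) ⟨a, Finset.mem_univ a, inv_two_pow_tangent_lt ha⟩
    rcases eq_or_ne (m b) (ℓ b) with hb | hb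
    · simp [hb]
    · exact (inv_two_pow_tangent_lt hb).le
  have heq : ∑ a, (2 : ℝ)⁻¹ ^ ℓ a * (1 - Real.log 2 * (m a - ℓ a)) =
      ∑ a, (2 : ℝ)⁻¹ ^ ℓ a - Real.log 2 *
        (∑ a, (2 : ℝ)⁻¹ ^ ℓ a * m a - ∑ a, (2 : ℝ)⁻¹ ^ ℓ a * ℓ a) := by
    rw [← Finset.sum_sub_distrib, Finset.mul_sum, ← Finset.sum_sub_distrib]
    exact Finset.sum_congr rfl fun b _ => by ring
  have := mul_nonneg (Real.log_pos one_lt_two).le (sub_nonneg.2 h)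
  linarith

theorem stmt5 {A : Type*} [Fintype A] (n : ℕ) (hn : 2 ≤ n) (hcard : Fintype.card A = n)
    (ℓ : A → ℕ) (hℓ : ∑ a, ((2 : ℝ))⁻¹ ^ ℓ a = 1)
    (C : A → List Bool) (hC : IsPrefixCode C)
    (hopt : ∀ ψ : A → List Bool, IsPrefixCode ψ →
      expLen (fun a => (2 : ℝ)⁻¹ ^ ℓ a) C ≤ expLen (fun a => (2 : ℝ)⁻¹ ^ ℓ a) ψ) :
    ∀ a, (C a).length = ℓ a := by
  have : Nontrivial A := Fintype.one_lt_card_iff_nontrivial.1 (by omega)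
  obtain ⟨ψ, hψ, hlen⟩ := exists_isPrefixCode_length_eq ℓ hℓ.le
  have hle := hopt ψ hψ
  simp only [expLen, hlen] at hle
  exact congrFun (length_eq_of_sum_mul_le (m := fun a => (C a).length) hℓ hC.kraft hle)
end
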